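/- Assume Setup (†). Then for all sufficiently large n and for each i ∈ [r], the induced subgraph G[V_i \ L] has at most a edges; furthermore, for each i ∈ [r] there exists an independent set I_i ⊆ V_i \ L of G with |I_i| ≥ |V_i| − ε^{1/3} n − a. -/

import Mathlib

open SimpleGraph

/-- The adjacency matrix of a simple graph over `ℝ`. -/
noncomputable def adjMat {V : Type*} [Fintype V] (G : SimpleGraph V) : Matrix V V ℝ :=
  letI := Classical.decRel G.Adj
  G.adjMatrix ℝ

/-- The spectral radius of a simple graph: the largest eigenvalue of its adjacency matrix. -/
noncomputable def specRad {V : Type*} [Fintype V] [DecidableEq V] (G : SimpleGraph V) : ℝ :=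
  sSup (spectrum ℝ (adjMat G))

/-- The number of edges of a simple graph. -/
noncomputable def eCnt {V : Type*} (G : SimpleGraph V) : ℕ := Nat.card G.edgeSet

/-- `G` contains a copy of `F` (a subgraph isomorphic to `F`). -/
def Contains {W V : Type*} (F : SimpleGraph W) (G : SimpleGraph V) : Prop :=
  ∃ f : F →g G, Function.Injective f

/-- `G` is `F`-free. -/
def FFree {W V : Type*} (F : SimpleGraph W) (G : SimpleGraph V) : Prop := ¬ Contains F G

/-- The Turán number `ex(n, F)`. -/
noncomputable def exNum {W : Type*} (n : ℕ) (F : SimpleGraph W) : ℕ :=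
  sSup {m | ∃ G : SimpleGraph (Fin n), FFree F G ∧ eCnt G = m}

/-- `G` is obtained from the Turán graph `T_{n,r}` by adding `a` edges. -/
def TuranPlus (n r a : ℕ) (G : SimpleGraph (Fin n)) : Prop :=
  (∃ H : SimpleGraph (Fin n), H ≤ G ∧ Nonempty (H ≃g turanGraph n r)) ∧
    eCnt G = eCnt (turanGraph n r) + a

/-- Hypothesis (★): for all sufficiently large `m`, `ex(m,F) = e(T_{m,r}) + a` and every
extremal graph is obtained from `T_{m,r}` by adding `a` edges. -/
def HypStar {W : Type*} (r a : ℕ) (F : SimpleGraph W) : Prop :=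
  ∃ m₀ : ℕ, ∀ m ≥ m₀,
    exNum m F = eCnt (turanGraph m r) + a ∧
    ∀ G : SimpleGraph (Fin m), FFree F G → eCnt G = exNum m F → TuranPlus m r a G

/-- `G` is a spectral-extremal `F`-free graph on its vertex set. -/
def SpecExtremal {W : Type*} (F : SimpleGraph W) {n : ℕ} (G : SimpleGraph (Fin n)) : Prop :=
  FFree F G ∧ ∀ G' : SimpleGraph (Fin n), FFree F G' → specRad G' ≤ specRad G

/-- Number of edges of `G` joining two distinct parts of the partition `p`. -/
noncomputable def crossCnt {n r : ℕ} (G : SimpleGraph (Fin n)) (p : Fin n → Fin r) : ℕ :=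
  Nat.card {e : Sym2 (Fin n) // e ∈ G.edgeSet ∧ ¬ (Sym2.map p e).IsDiag}

/-- Number of edges of `G` inside part `i` of the partition `p`, i.e. `e(G[Vᵢ])`. -/
noncomputable def inCnt {n r : ℕ} (G : SimpleGraph (Fin n)) (p : Fin n → Fin r)
    (i : Fin r) : ℕ :=
  Nat.card {e : Sym2 (Fin n) // e ∈ G.edgeSet ∧ Sym2.map p e = Sym2.diag i}

/-- The size of part `i` of the partition `p`, i.e. `|Vᵢ|`. -/
noncomputable def partSize {n r : ℕ} (p : Fin n → Fin r) (i : Fin r) : ℕ :=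
  Nat.card {v : Fin n // p v = i}

/-- The degree of `v` in `G`. -/
noncomputable def deg {n : ℕ} (G : SimpleGraph (Fin n)) (v : Fin n) : ℕ :=
  Nat.card (G.neighborSet v)

/-- `d_{Vᵢ}(v)`, the number of neighbours of `v` in part `i` of the partition `p`. -/
noncomputable def degIn {n r : ℕ} (G : SimpleGraph (Fin n)) (p : Fin n → Fin r)
    (i : Fin r) (v : Fin n) : ℕ :=
  Nat.card {w : Fin n // G.Adj v w ∧ p w = i}

/-- The partition `p` into `r` parts maximizes the number of edges between distinct parts,
`∑ eᵢ(Vᵢ) ≤ ε n²`, and each part has size strictly between `(1/r − 3√ε)n` and `(1/r + 3√ε)n`. -/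
def GoodPartition (r : ℕ) {n : ℕ} (G : SimpleGraph (Fin n)) (ε : ℝ)
    (p : Fin n → Fin r) : Prop :=
  (∀ q : Fin n → Fin r, crossCnt G q ≤ crossCnt G p) ∧
  (∑ i : Fin r, (inCnt G p i : ℝ)) ≤ ε * n ^ 2 ∧
  ∀ i : Fin r, (1 / (r : ℝ) - 3 * Real.sqrt ε) * n < partSize p i ∧
    (partSize p i : ℝ) < (1 / (r : ℝ) + 3 * Real.sqrt ε) * n

/-- The set `L` of low-degree vertices. -/
def Lset (r : ℕ) {n : ℕ} (G : SimpleGraph (Fin n)) (ε : ℝ) : Set (Fin n) :=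
  {v | (deg G v : ℝ) ≤ (1 - 1 / (r : ℝ) - 3 * r * ε ^ ((1 : ℝ) / 3)) * n}

/-- The set `W` of vertices with many neighbours inside their own part. -/
def Wset {n r : ℕ} (G : SimpleGraph (Fin n)) (p : Fin n → Fin r) (θ : ℝ) : Set (Fin n) :=
  {v | 2 * θ * n ≤ (degIn G p (p v) v : ℝ)}

open Finset Matrix

section Spectral

/-- The Rayleigh bound for a real symmetric matrix. -/
lemma dotProduct_mulVec_le_sSup_spectrum {V : Type*} [Fintype V] [DecidableEq V]
    {A : Matrix V V ℝ} (hA : A.IsHermitian) (x : V → ℝ) :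
    x ⬝ᵥ A *ᵥ x ≤ sSup (spectrum ℝ A) * (x ⬝ᵥ x) := by
  set μ := sSup (spectrum ℝ A)
  have hB : (algebraMap ℝ (Matrix V V ℝ) μ - A).PosSemidef := by
    rw [posSemidef_iff_isHermitian_and_spectrum_nonneg]
    refine ⟨?_, ?_⟩
    · refine IsHermitian.sub ?_ hA
      rw [Matrix.algebraMap_eq_diagonal]
      exact isHermitian_diagonal _
    · rw [← spectrum.singleton_sub_eq]
      rintro _ ⟨_, rfl, z, hz, rfl⟩
      exact sub_nonneg.2 (le_csSup A.finite_spectrum.bddAbove hz)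
  have := hB.dotProduct_mulVec_nonneg x
  rw [sub_mulVec, dotProduct_sub, Algebra.algebraMap_eq_smul_one, smul_mulVec, one_mulVec,
    dotProduct_smul] at this
  simpa using this

/-- The largest eigenvalue of a real symmetric matrix has a unit eigenvector. -/
lemma exists_mulVec_eq_sSup_spectrum {V : Type*} [Fintype V] [DecidableEq V] [Nonempty V]
    {A : Matrix V V ℝ} (hA : A.IsHermitian) :
    ∃ x : V → ℝ, ∑ u, x u ^ 2 = 1 ∧ A *ᵥ x = sSup (spectrum ℝ A) • x := by
  have hmem : sSup (spectrum ℝ A) ∈ spectrum ℝ A := by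
    refine Set.Nonempty.csSup_mem ?_ A.finite_spectrum
    rw [hA.spectrum_real_eq_range_eigenvalues]
    exact Set.range_nonempty _
  generalize sSup (spectrum ℝ A) = μ at hmem ⊢
  rw [hA.spectrum_real_eq_range_eigenvalues] at hmem
  obtain ⟨j, rfl⟩ := hmem
  refine ⟨⇑(hA.eigenvectorBasis j), ?_, hA.mulVec_eigenvectorBasis j⟩
  have h1 := hA.eigenvectorBasis.orthonormal.1 j
  have h2 := EuclideanSpace.norm_sq_eq (hA.eigenvectorBasis j)
  rw [h1] at h2
  simpa using h2.symm

lemma isHermitian_adjMat {V : Type*} [Fintype V] (G : SimpleGraph V) :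
    (adjMat G).IsHermitian := by
  let := Classical.decRel G.Adj
  exact G.isHermitian_adjMatrix ℝ

open scoped Classical in
lemma adjMat_apply {V : Type*} [Fintype V] (G : SimpleGraph V) (u v : V) :
    adjMat G u v = if G.Adj u v then 1 else 0 := by
  simp [adjMat, SimpleGraph.adjMatrix_apply]

open scoped Classical in
lemma two_mul_eCnt {V : Type*} [Fintype V] (G : SimpleGraph V) :
    2 * eCnt G = #{x : V × V | G.Adj x.1 x.2} := by
  rw [eCnt, Nat.card_eq_fintype_card, ← SimpleGraph.edgeFinset_card,
    SimpleGraph.two_mul_card_edgeFinset]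

/-- The spectral radius is at least the average degree. -/
lemma two_mul_eCnt_le_specRad_mul {n : ℕ} (G : SimpleGraph (Fin n)) :
    2 * (eCnt G : ℝ) ≤ specRad G * n := by
  classical
  have h := dotProduct_mulVec_le_sSup_spectrum (isHermitian_adjMat G) (fun _ => 1)
  have h2 : (2 * (eCnt G : ℝ)) = ∑ u, ∑ v, if G.Adj u v then (1 : ℝ) else 0 := by
    have := two_mul_eCnt G
    rw [Finset.card_filter, Fintype.sum_prod_type] at this
    exact_mod_cast this
  rw [h2]
  simpa [dotProduct, mulVec, adjMat_apply, specRad] using h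

open scoped Classical in
/-- A nonnegative unit vector which witnesses the spectral radius and has flat entries. -/
lemma exists_flat_vector {n : ℕ} (hn : 0 < n) (G : SimpleGraph (Fin n)) :
    ∃ y : Fin n → ℝ, (∀ u, 0 ≤ y u) ∧ ∑ u, y u ^ 2 = 1 ∧
      specRad G ≤ ∑ x : Fin n × Fin n with G.Adj x.1 x.2, y x.1 * y x.2 ∧
      ∀ u, specRad G ^ 2 * y u ^ 2 ≤ n := by
  have : Nonempty (Fin n) := ⟨⟨0, hn⟩⟩
  obtain ⟨x, hx1, hx⟩ := exists_mulVec_eq_sSup_spectrum (isHermitian_adjMat G)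
  change adjMat G *ᵥ x = specRad G • x at hx
  have hx' : ∀ u, specRad G * x u = ∑ v, if G.Adj u v then x v else 0 := fun u => by
    have := congrFun hx u
    simp only [mulVec, dotProduct, adjMat_apply, ite_mul, one_mul, zero_mul, Pi.smul_apply,
      smul_eq_mul] at this
    exact this.symm
  refine ⟨fun u => |x u|, fun u => abs_nonneg _, by simpa using hx1, ?_, fun u => ?_⟩
  · have : specRad G = ∑ u, ∑ v, if G.Adj u v then x u * x v else 0 := by
      calc specRad G = ∑ u, x u * (specRad G * x u) := by
            have h : ∀ u, x u * (specRad G * x u) = specRad G * x u ^ 2 := fun u => by ring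
            simp_rw [h, ← Finset.mul_sum, hx1, mul_one]
        _ = _ := by
            refine Finset.sum_congr rfl fun u _ => ?_
            rw [hx', Finset.mul_sum]
            exact Finset.sum_congr rfl fun v _ => by split_ifs <;> simp
    rw [this, Finset.sum_filter, Fintype.sum_prod_type]
    refine Finset.sum_le_sum fun u _ => Finset.sum_le_sum fun v _ => ?_
    split_ifs
    · rw [← abs_mul]; exact le_abs_self _
    · exact le_rfl
  · rw [sq_abs, ← mul_pow, hx' u, ← Finset.sum_filter]
    calc _ ≤ (#{v | G.Adj u v} : ℝ) * ∑ v with G.Adj u v, x v ^ 2 := sq_sum_le_card_mul_sum_sq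
      _ ≤ n * 1 := by
        gcongr
        · exact_mod_cast (Finset.card_le_univ _).trans (by simp)
        · rw [← hx1]
          exact Finset.sum_le_univ_sum_of_nonneg fun v => sq_nonneg _
      _ = n := mul_one _

end Spectral

section Counting

open scoped Classical in
/-- The number of vertices in other parts of `p` which are not adjacent to `u`. -/
noncomputable def missDeg {n r : ℕ} (G : SimpleGraph (Fin n)) (p : Fin n → Fin r)
    (u : Fin n) : ℕ :=
  #{w | p u ≠ p w ∧ ¬ G.Adj u w}

/-- The complete multipartite case of the Motzkin–Straus inequality. -/
lemma sum_cross_mul_le {n r : ℕ} (hr : 0 < r) (p : Fin n → Fin r) (w : Fin n → ℝ) :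
    ∑ x : Fin n × Fin n with p x.1 ≠ p x.2, w x.1 * w x.2 ≤
      (1 - 1 / (r : ℝ)) * (∑ u, w u) ^ 2 := by
  have htot : ∑ x : Fin n × Fin n, w x.1 * w x.2 = (∑ u, w u) ^ 2 := by
    rw [Fintype.sum_prod_type, sq, Finset.sum_mul_sum]
  have hsplit := Finset.sum_filter_add_sum_filter_not (univ : Finset (Fin n × Fin n))
    (fun x => p x.1 = p x.2) (fun x => w x.1 * w x.2)
  have hsame : ∑ x : Fin n × Fin n with p x.1 = p x.2, w x.1 * w x.2 =
      ∑ i : Fin r, (∑ u with p u = i, w u) ^ 2 := by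
    rw [← Finset.sum_fiberwise (s := univ.filter fun x : Fin n × Fin n => p x.1 = p x.2)
      (g := fun x => p x.1)]
    refine Finset.sum_congr rfl fun i _ => ?_
    rw [sq, Finset.sum_mul_sum, ← Finset.sum_product', Finset.filter_filter]
    refine Finset.sum_congr ?_ fun _ _ => rfl
    ext ⟨u, v⟩
    simp only [mem_filter, mem_univ, true_and, mem_product]
    constructor
    · rintro ⟨h1, h2⟩; exact ⟨h2, h1 ▸ h2⟩
    · rintro ⟨h1, h2⟩; exact ⟨h1.trans h2.symm, h1⟩
  have hfib : ∑ i : Fin r, ∑ u with p u = i, w u = ∑ u, w u := Finset.sum_fiberwise _ _ _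
  have hcs := sq_sum_le_card_mul_sum_sq (s := (univ : Finset (Fin r)))
    (f := fun i => ∑ u with p u = i, w u)
  rw [hfib, Finset.card_univ, Fintype.card_fin] at hcs
  have hr' : (0 : ℝ) < r := by exact_mod_cast hr
  have : (∑ u, w u) ^ 2 / r ≤ ∑ i : Fin r, (∑ u with p u = i, w u) ^ 2 := by
    rw [div_le_iff₀ hr']; linarith
  rw [sub_mul, one_mul, one_div_mul_eq_div]
  simp only [ne_eq]
  linarith

lemma card_cross_le {n r : ℕ} (hr : 0 < r) (p : Fin n → Fin r) :
    (#{x : Fin n × Fin n | p x.1 ≠ p x.2} : ℝ) ≤ (1 - 1 / (r : ℝ)) * n ^ 2 := by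
  simpa using sum_cross_mul_le hr p (fun _ => 1)

open scoped Classical in
lemma sum_missDeg_add {n r : ℕ} (G : SimpleGraph (Fin n)) (p : Fin n → Fin r) :
    ∑ u, missDeg G p u + #{x : Fin n × Fin n | G.Adj x.1 x.2 ∧ p x.1 ≠ p x.2} =
      #{x : Fin n × Fin n | p x.1 ≠ p x.2} := by
  have h : ∑ u, missDeg G p u = #{x : Fin n × Fin n | p x.1 ≠ p x.2 ∧ ¬ G.Adj x.1 x.2} := by
    simp only [missDeg, Finset.card_filter, Fintype.sum_prod_type]
  rw [h, ← Finset.card_filter_add_card_filter_not (s := univ.filter fun x : Fin n × Fin n =>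
    p x.1 ≠ p x.2) (fun x => G.Adj x.1 x.2), Finset.filter_filter, Finset.filter_filter, add_comm]
  simp only [and_comm]

open scoped Classical in
/-- A graph with large spectral radius and few edges inside the parts of `p` misses few
edges between the parts. -/
lemma sum_missDeg_le {n r : ℕ} (hr : 2 ≤ r) (hn : 0 < n) (G : SimpleGraph (Fin n))
    (p : Fin n → Fin r) {ε : ℝ} (hε : 0 < ε) (hε' : ε ≤ 1 / 1000)
    (hlam : (1 - 1 / (r : ℝ) - ε) * n ≤ specRad G)
    (hin : (#{x : Fin n × Fin n | G.Adj x.1 x.2 ∧ p x.1 = p x.2} : ℝ) ≤ 2 * ε * n ^ 2) :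
    (∑ u, missDeg G p u : ℝ) ≤ 22 * ε * n ^ 2 := by
  have hn' : (0 : ℝ) < n := by exact_mod_cast hn
  have hr' : (2 : ℝ) ≤ r := by exact_mod_cast hr
  have hc : 1 / 2 ≤ 1 - 1 / (r : ℝ) := by
    have : 1 / (r : ℝ) ≤ 1 / 2 := one_div_le_one_div_of_le (by norm_num) hr'
    linarith
  set c := 1 - 1 / (r : ℝ)
  have hlam0 : 0 < specRad G := lt_of_lt_of_le (mul_pos (by linarith) hn') hlam
  obtain ⟨y, hy0, hy1, hy2, hy3⟩ := exists_flat_vector hn G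
  set lam := specRad G
  have hlamsq : n ^ 2 / 5 ≤ lam ^ 2 := by
    have h1 : 499 / 1000 * (n : ℝ) ≤ lam := le_trans (by gcongr; linarith) hlam
    nlinarith [pow_le_pow_left₀ (by positivity) h1 2, pow_pos hn' 2]
  have hM : ∀ u, y u ^ 2 ≤ 5 / n := fun u => by
    rw [le_div_iff₀ hn']
    have := hy3 u
    have h2 : (n : ℝ) ^ 2 / 5 * y u ^ 2 ≤ n := le_trans (by gcongr) this
    nlinarith
  have hsplit : ∑ x : Fin n × Fin n with G.Adj x.1 x.2, y x.1 * y x.2 =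
      ∑ x : Fin n × Fin n with G.Adj x.1 x.2 ∧ p x.1 = p x.2, y x.1 * y x.2 +
      ∑ x : Fin n × Fin n with G.Adj x.1 x.2 ∧ p x.1 ≠ p x.2, y x.1 * y x.2 := by
    rw [← Finset.sum_filter_add_sum_filter_not _ (fun x => p x.1 = p x.2),
      Finset.filter_filter, Finset.filter_filter]
  have hinside : ∑ x : Fin n × Fin n with G.Adj x.1 x.2 ∧ p x.1 = p x.2, y x.1 * y x.2 ≤
      10 * ε * n := by
    calc _ ≤ ∑ x : Fin n × Fin n with G.Adj x.1 x.2 ∧ p x.1 = p x.2, (5 / n : ℝ) := by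
          refine Finset.sum_le_sum fun x _ => ?_
          nlinarith [hM x.1, hM x.2, sq_nonneg (y x.1 - y x.2)]
      _ ≤ 2 * ε * n ^ 2 * (5 / n) := by
          rw [Finset.sum_const, nsmul_eq_mul]; gcongr
      _ = 10 * ε * n := by field_simp; ring
  set K : Finset (Fin n × Fin n) := {x | G.Adj x.1 x.2 ∧ p x.1 ≠ p x.2} with hK
  set X := ∑ x ∈ K, y x.1 * y x.2
  have hXlow : (c - 11 * ε) * n ≤ X := by linarith
  have hXup : X ^ 2 ≤ #K * c := by
    calc X ^ 2 ≤ #K * ∑ x ∈ K, (y x.1 * y x.2) ^ 2 := sq_sum_le_card_mul_sum_sq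
      _ ≤ #K * c := by
        gcongr
        have := sum_cross_mul_le (by omega) p (fun u => y u ^ 2)
        rw [hy1, one_pow, mul_one] at this
        refine le_trans ?_ this
        simp only [mul_pow]
        refine Finset.sum_le_sum_of_subset_of_nonneg ?_ fun _ _ _ => by positivity
        exact fun x hx => by simp only [hK, mem_filter] at hx ⊢; exact ⟨hx.1, hx.2.2⟩
  have hElow : (c - 22 * ε) * n ^ 2 ≤ #K := by
    have h1 := pow_le_pow_left₀ (mul_nonneg (by linarith) hn'.le) hXlow 2
    have h2 : c * ((c - 22 * ε) * n ^ 2) ≤ c * #K := by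
      nlinarith [mul_nonneg (sq_nonneg ε) (sq_nonneg (n : ℝ))]
    exact le_of_mul_le_mul_left h2 (by linarith)
  have h1 := card_cross_le (by omega) p
  have h2 : _ + #K = _ := sum_missDeg_add G p
  rw [← h2] at h1
  push_cast at h1
  linarith

open scoped Classical in
lemma two_mul_card_edges_filter {V : Type*} [Fintype V] (G : SimpleGraph V)
    (Q : Sym2 V → Prop) :
    2 * Nat.card {e : Sym2 V // e ∈ G.edgeSet ∧ Q e} =
      #{x : V × V | G.Adj x.1 x.2 ∧ Q s(x.1, x.2)} := by
  have h := two_mul_eCnt (SimpleGraph.fromEdgeSet {e : Sym2 V | e ∈ G.edgeSet ∧ Q e})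
  have hset : {e : Sym2 V | e ∈ G.edgeSet ∧ Q e} \ Sym2.diagSet =
      {e : Sym2 V | e ∈ G.edgeSet ∧ Q e} :=
    sdiff_eq_left.2 (Set.disjoint_left.2 fun e he hd => G.not_isDiag_of_mem_edgeSet he.1 hd)
  rw [eCnt, SimpleGraph.edgeSet_fromEdgeSet] at h
  rw [show Nat.card {e : Sym2 V // e ∈ G.edgeSet ∧ Q e} =
    Nat.card ({e : Sym2 V | e ∈ G.edgeSet ∧ Q e} : Set (Sym2 V)) from rfl]
  rw [hset] at h
  rw [h]
  congr 1
  ext x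
  simp only [SimpleGraph.fromEdgeSet_adj, Set.mem_ofPred_eq, SimpleGraph.mem_edgeSet, mem_filter,
    mem_univ, true_and]
  exact ⟨fun h => h.1, fun h => ⟨h, h.1.ne⟩⟩

open scoped Classical in
lemma two_mul_sum_inCnt {n r : ℕ} (G : SimpleGraph (Fin n)) (p : Fin n → Fin r) :
    2 * ∑ i, inCnt G p i = #{x : Fin n × Fin n | G.Adj x.1 x.2 ∧ p x.1 = p x.2} := by
  rw [Finset.mul_sum, Finset.card_eq_sum_card_fiberwise (f := fun x => p x.1) (t := univ)
    (fun _ _ => by simp)]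
  refine Finset.sum_congr rfl fun i _ => ?_
  rw [inCnt, two_mul_card_edges_filter, Finset.filter_filter]
  congr 1
  ext x
  simp only [Sym2.map_mk, Sym2.diag, mem_filter, mem_univ, true_and, Sym2.eq_iff]
  grind

open scoped Classical in
lemma two_mul_crossCnt {n r : ℕ} (G : SimpleGraph (Fin n)) (p : Fin n → Fin r) :
    2 * crossCnt G p = #{x : Fin n × Fin n | G.Adj x.1 x.2 ∧ p x.1 ≠ p x.2} := by
  rw [crossCnt, two_mul_card_edges_filter]
  simp

open scoped Classical in
/-- Cross pairs, split according to whether they use the vertex `v`. -/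
lemma two_mul_crossCnt_eq {n r : ℕ} (G : SimpleGraph (Fin n)) (p : Fin n → Fin r) (v : Fin n) :
    2 * crossCnt G p =
      #{x : Fin n × Fin n | (x.1 ≠ v ∧ x.2 ≠ v) ∧ G.Adj x.1 x.2 ∧ p x.1 ≠ p x.2} +
        2 * #{w | G.Adj v w ∧ p w ≠ p v} := by
  have h1 : #{x : Fin n × Fin n | (x.1 = v) ∧ G.Adj x.1 x.2 ∧ p x.1 ≠ p x.2} =
      #{w | G.Adj v w ∧ p w ≠ p v} := by
    refine (Finset.card_bij (fun w _ => (v, w)) ?_ ?_ ?_).symm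
    · intro w hw; simp only [mem_filter, mem_univ, true_and] at hw ⊢; exact ⟨hw.1, hw.2.symm⟩
    · intro a _ b _ h; exact (Prod.ext_iff.1 h).2
    · rintro ⟨a, b⟩ h
      simp only [mem_filter, mem_univ, true_and] at h
      obtain ⟨rfl, h⟩ := h
      exact ⟨b, by simpa using ⟨h.1, h.2.symm⟩, rfl⟩
  have h2 : #{x : Fin n × Fin n | (x.2 = v) ∧ G.Adj x.1 x.2 ∧ p x.1 ≠ p x.2} =
      #{w | G.Adj v w ∧ p w ≠ p v} := by
    refine (Finset.card_bij (fun w _ => (w, v)) ?_ ?_ ?_).symm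
    · intro w hw; simp only [mem_filter, mem_univ, true_and] at hw ⊢; exact ⟨hw.1.symm, hw.2⟩
    · intro a _ b _ h; exact (Prod.ext_iff.1 h).1
    · rintro ⟨a, b⟩ h
      simp only [mem_filter, mem_univ, true_and] at h
      obtain ⟨rfl, h⟩ := h
      exact ⟨a, by simpa using ⟨h.1.symm, h.2⟩, rfl⟩
  rw [two_mul_crossCnt, two_mul]
  nth_rw 2 [← h1]
  rw [← h2, ← Finset.card_union_of_disjoint, ← Finset.card_union_of_disjoint]
  · congr 1
    ext x
    simp only [mem_filter, mem_univ, true_and, mem_union]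
    tauto
  all_goals
    rw [Finset.disjoint_left]
    intro x hx
    simp only [mem_filter, mem_univ, true_and, mem_union] at hx ⊢
    rcases x with ⟨x1, x2⟩
    simp only at hx ⊢
    grind

open scoped Classical in
lemma degIn_eq {n r : ℕ} (G : SimpleGraph (Fin n)) (p : Fin n → Fin r) (j : Fin r) (v : Fin n) :
    degIn G p j v = #{w | G.Adj v w ∧ p w = j} := by
  rw [degIn, Nat.card_eq_fintype_card, Fintype.card_subtype]

/-- In a maximum cut every vertex has at least as many neighbours in any other part as in
its own. -/
lemma degIn_self_le {n r : ℕ} (G : SimpleGraph (Fin n)) (p : Fin n → Fin r)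
    (hp : ∀ q : Fin n → Fin r, crossCnt G q ≤ crossCnt G p) (v : Fin n) (j : Fin r) :
    degIn G p (p v) v ≤ degIn G p j v := by
  classical
  have h := hp (Function.update p v j)
  have h1 := two_mul_crossCnt_eq G p v
  have h2 := two_mul_crossCnt_eq G (Function.update p v j) v
  have h3 : #{x : Fin n × Fin n | (x.1 ≠ v ∧ x.2 ≠ v) ∧ G.Adj x.1 x.2 ∧
      Function.update p v j x.1 ≠ Function.update p v j x.2} =
      #{x : Fin n × Fin n | (x.1 ≠ v ∧ x.2 ≠ v) ∧ G.Adj x.1 x.2 ∧ p x.1 ≠ p x.2} := by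
    congr 1
    ext x
    simp only [mem_filter, mem_univ, true_and]
    refine and_congr_right fun hx => ?_
    rw [Function.update_of_ne hx.1, Function.update_of_ne hx.2]
  have h4 : #{w | G.Adj v w ∧ Function.update p v j w ≠ Function.update p v j v} =
      #{w | G.Adj v w ∧ p w ≠ j} := by
    congr 1
    ext w
    simp only [mem_filter, mem_univ, true_and]
    refine and_congr_right fun hw => ?_
    rw [Function.update_of_ne hw.ne', Function.update_self]
  have hs : ∀ k, #{w | G.Adj v w ∧ p w = k} + #{w | G.Adj v w ∧ p w ≠ k} = #{w | G.Adj v w} := by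
    intro k
    rw [← Finset.card_filter_add_card_filter_not (s := univ.filter fun w => G.Adj v w)
      (fun w => p w = k), Finset.filter_filter, Finset.filter_filter]
  have h5 := hs j
  have h6 := hs (p v)
  rw [degIn_eq, degIn_eq]
  omega

end Counting

section Extremal

lemma eCnt_le_exNum {W : Type*} {F : SimpleGraph W} {n : ℕ} {G : SimpleGraph (Fin n)}
    (hG : FFree F G) : eCnt G ≤ exNum n F := by
  refine le_csSup ⟨Nat.card (Sym2 (Fin n)), ?_⟩ ⟨G, hG, rfl⟩
  rintro _ ⟨H, -, rfl⟩
  exact Nat.card_le_card_of_injective _ Subtype.val_injective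

lemma eCnt_turanGraph (n r : ℕ) :
    eCnt (turanGraph n r) = #(turanGraph n r).edgeFinset := by
  rw [eCnt, Nat.card_eq_fintype_card, ← SimpleGraph.edgeFinset_card]

lemma le_two_mul_eCnt_turanGraph {n r : ℕ} (hr : 0 < r) :
    (1 - 1 / (r : ℝ)) * n ^ 2 - (r ^ 2 + 2) ≤ 2 * eCnt (turanGraph n r) := by
  rw [eCnt_turanGraph, card_edgeFinset_turanGraph]
  have hs : n % r < r := Nat.mod_lt _ hr
  have hs' : n % r ≤ n := Nat.mod_le _ _
  generalize n % r = s at hs hs'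
  have h1 : (n ^ 2 - s ^ 2) * (r - 1) <
      2 * r * ((n ^ 2 - s ^ 2) * (r - 1) / (2 * r) + 1) := Nat.lt_mul_div_succ _ (by omega)
  generalize (n ^ 2 - s ^ 2) * (r - 1) / (2 * r) = q at h1
  have h2 : ((n : ℝ) ^ 2 - s ^ 2) * (r - 1) ≤ 2 * r * (q + 1) := by
    have h3 : (((n ^ 2 - s ^ 2) * (r - 1) : ℕ) : ℝ) ≤ ((2 * r * (q + 1) : ℕ) : ℝ) := by
      exact_mod_cast h1.le
    rw [Nat.cast_mul, Nat.cast_sub (Nat.pow_le_pow_left hs' 2), Nat.cast_sub hr] at h3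
    push_cast at h3
    exact h3
  have hr' : (1 : ℝ) ≤ r := by exact_mod_cast hr
  have hsr : (s : ℝ) ≤ r := by exact_mod_cast hs.le
  have hsr2 : (s : ℝ) ^ 2 ≤ r ^ 2 := by gcongr
  have h4 : ((n : ℝ) ^ 2 - s ^ 2) * (1 - 1 / r) ≤ 2 * (q + 1) := by
    have : ((n : ℝ) ^ 2 - s ^ 2) * (1 - 1 / r) = ((n : ℝ) ^ 2 - s ^ 2) * (r - 1) / r := by
      field_simp
    rw [this, div_le_iff₀ (by linarith)]
    linarith
  have h5 : (s : ℝ) ^ 2 * (1 - 1 / r) ≤ r ^ 2 * 1 := by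
    have : 0 ≤ 1 / (r : ℝ) := by positivity
    have : 1 / (r : ℝ) ≤ 1 := by rw [div_le_one (by linarith)]; exact hr'
    gcongr
    linarith
  have h6 : (0 : ℝ) ≤ (s.choose 2 : ℕ) := by positivity
  push_cast
  linarith

/-- The spectral radius of a spectral-extremal graph is asymptotically at least that of the
Turán graph. -/
lemma le_specRad_of_specExtremal {W : Type*} {r a : ℕ} (hr : 2 ≤ r) {F : SimpleGraph W}
    (h : HypStar r a F) {ε : ℝ} (hε : 0 < ε) :
    ∃ n₀ : ℕ, ∀ n ≥ n₀, ∀ G : SimpleGraph (Fin n), SpecExtremal F G →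
      (1 - 1 / (r : ℝ) - ε) * n ≤ specRad G := by
  obtain ⟨m₀, hm⟩ := h
  obtain ⟨k, hk⟩ := exists_nat_gt (((r : ℝ) ^ 2 + 2) / ε)
  refine ⟨m₀ + k + 1, fun n hn G hG => ?_⟩
  have hT := le_two_mul_eCnt_turanGraph (n := n) (r := r) (by omega)
  have hex := (hm n (by omega)).1
  have hn1 : (1 : ℝ) ≤ n := by exact_mod_cast (by omega : 1 ≤ n)
  have hkn : (k : ℝ) ≤ n := by exact_mod_cast (by omega : k ≤ n)
  have hbig : (r : ℝ) ^ 2 + 2 ≤ ε * n ^ 2 := by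
    rw [div_lt_iff₀ hε] at hk
    calc (r : ℝ) ^ 2 + 2 ≤ k * ε := hk.le
      _ ≤ n * ε := by gcongr
      _ ≤ n ^ 2 * ε := by gcongr; nlinarith
      _ = ε * n ^ 2 := mul_comm _ _
  have hexr : (exNum n F : ℝ) = eCnt (turanGraph n r) + a := by exact_mod_cast hex
  have ha : (0 : ℝ) ≤ a := by positivity
  have hlow : (1 - 1 / (r : ℝ) - ε) * n ^ 2 ≤ 2 * exNum n F := by linarith
  have hne : {m | ∃ G : SimpleGraph (Fin n), FFree F G ∧ eCnt G = m}.Nonempty :=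
    ⟨_, G, hG.1, rfl⟩
  obtain ⟨G', hG', he⟩ : ∃ G' : SimpleGraph (Fin n), FFree F G' ∧ eCnt G' = exNum n F := by
    refine Nat.sSup_mem hne ⟨exNum n F, ?_⟩
    rintro _ ⟨H, hH, rfl⟩
    exact eCnt_le_exNum hH
  have h1 := two_mul_eCnt_le_specRad_mul G'
  have h2 : specRad G' * n ≤ specRad G * n := by gcongr; exact hG.2 G' hG'
  rw [he] at h1
  have h3 : (1 - 1 / (r : ℝ) - ε) * n * n ≤ specRad G * n := by nlinarith
  exact le_of_mul_le_mul_right h3 (by linarith)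

open scoped Classical in
/-- A vertex set spanning more than `ex(m, F)` edges contains `F`. -/
lemma contains_of_exNum_lt {W : Type*} {F : SimpleGraph W} {n : ℕ} {G : SimpleGraph (Fin n)}
    (U : Finset (Fin n)) (hU : 2 * exNum #U F < #{x ∈ U ×ˢ U | G.Adj x.1 x.2}) :
    Contains F G := by
  by_contra hG
  let e : Fin #U ≃ U := U.equivFin.symm
  let φ : Fin #U → Fin n := fun k => e k
  have hφ : Function.Injective φ := Subtype.val_injective.comp e.injective
  have hfree : FFree F (G.comap φ) := by
    rintro ⟨f, hf⟩
    exact hG ⟨⟨fun w => φ (f w), fun hw => f.map_rel hw⟩, hφ.comp hf⟩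
  have h1 := eCnt_le_exNum hfree
  have h2 : 2 * eCnt (G.comap φ) = #{x : Fin #U × Fin #U | (G.comap φ).Adj x.1 x.2} := by
    convert! two_mul_eCnt (G.comap φ)
  have h3 : #{x : Fin #U × Fin #U | (G.comap φ).Adj x.1 x.2} =
      #{x ∈ U ×ˢ U | G.Adj x.1 x.2} := by
    refine Finset.card_bij (fun x _ => (φ x.1, φ x.2)) ?_ ?_ ?_
    · intro x hx
      simp only [mem_filter, mem_univ, true_and, mem_product] at hx ⊢
      exact ⟨⟨(e x.1).2, (e x.2).2⟩, hx⟩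
    · intro x _ y _ hxy
      exact Prod.ext (hφ (Prod.ext_iff.1 hxy).1) (hφ (Prod.ext_iff.1 hxy).2)
    · rintro ⟨u, w⟩ hx
      simp only [mem_filter, mem_product] at hx
      refine ⟨(e.symm ⟨u, hx.1.1⟩, e.symm ⟨w, hx.1.2⟩), ?_, ?_⟩
      · simp only [mem_filter, mem_univ, true_and, SimpleGraph.comap_adj, φ,
          Equiv.apply_symm_apply]
        exact hx.2
      · simp [φ]
  omega

open scoped Classical in
/-- A balanced complete `r`-partite graph with `a + 1` further edges inside the parts
contains `F`. -/
lemma contains_of_balanced {W : Type*} {F : SimpleGraph W} {n r t a : ℕ} (hr : 0 < r)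
    (hF : exNum (r * t) F = eCnt (turanGraph (r * t) r) + a)
    {G : SimpleGraph (Fin n)} {p : Fin n → Fin r} (U : Finset (Fin n))
    (hU : ∀ j, #{u ∈ U | p u = j} = t)
    (hadj : ∀ u ∈ U, ∀ w ∈ U, p u ≠ p w → G.Adj u w)
    (hin : 2 * (a + 1) ≤ #{x ∈ U ×ˢ U | G.Adj x.1 x.2 ∧ p x.1 = p x.2}) :
    Contains F G := by
  have hcard : #U = r * t := by
    rw [Finset.card_eq_sum_card_fiberwise (f := p) (t := univ) (fun _ _ => by simp)]
    simp [hU]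
  have hsame : #{x ∈ U ×ˢ U | p x.1 = p x.2} = r * t ^ 2 := by
    rw [Finset.card_eq_sum_card_fiberwise (f := fun x => p x.1) (t := univ) (fun _ _ => by simp)]
    rw [Finset.sum_congr rfl (g := fun _ => t ^ 2)]
    · simp
    intro j _
    rw [sq, ← hU j, ← Finset.card_product]
    congr 1
    ext x
    simp only [mem_filter, mem_product]
    grind
  have hsplit := Finset.card_filter_add_card_filter_not (s := U ×ˢ U) (fun x => p x.1 = p x.2)
  rw [Finset.card_product, hcard, hsame] at hsplit
  have hsplit' := Finset.card_filter_add_card_filter_not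
    (s := (U ×ˢ U).filter fun x => G.Adj x.1 x.2) (fun x => p x.1 = p x.2)
  rw [Finset.filter_filter, Finset.filter_filter] at hsplit'
  have hcross : #{x ∈ U ×ˢ U | G.Adj x.1 x.2 ∧ ¬ p x.1 = p x.2} =
      #{x ∈ U ×ˢ U | ¬ p x.1 = p x.2} := by
    congr 1
    ext x
    simp only [mem_filter, mem_product]
    exact ⟨fun h => ⟨h.1, h.2.2⟩, fun h => ⟨h.1, hadj _ h.1.1 _ h.1.2 h.2, h.2⟩⟩
  refine contains_of_exNum_lt U ?_
  rw [hcard, hF, eCnt_turanGraph]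
  have hT := mul_card_edgeFinset_turanGraph_le (n := r * t) (r := r)
  generalize #(turanGraph (r * t) r).edgeFinset = T at hT ⊢
  have hT' : 2 * T + r * t ^ 2 ≤ r * t * (r * t) := by
    refine Nat.le_of_mul_le_mul_left ?_ hr
    obtain ⟨s, rfl⟩ : ∃ s, r = s + 1 := ⟨r - 1, by omega⟩
    simp only [Nat.add_sub_cancel] at hT
    nlinarith
  omega

end Extremal

section Greedy

open scoped Classical in
/-- Greedy choice of conflict-free representatives. -/
lemma exists_conflict_free {V ι : Type*} [Fintype V] [Fintype ι] (C : V → V → Prop)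
    (hC : ∀ x y, C x y → C y x) (b : ℕ) (T : ι → Finset V)
    (hb : ∀ k, ∀ w ∈ T k, #{x | C w x} ≤ b) (hT : ∀ k, Fintype.card ι * b < #(T k)) :
    ∃ f : ι → V, (∀ k, f k ∈ T k) ∧ ∀ k l, k ≠ l → ¬ C (f k) (f l) := by
  have key : ∀ s : Finset ι, ∃ f : ι → V, (∀ k, f k ∈ T k) ∧
      ∀ k ∈ s, ∀ l ∈ s, k ≠ l → ¬ C (f k) (f l) := by
    intro s
    induction s using Finset.induction_on with
    | empty =>
      have hne : ∀ k, (T k).Nonempty := fun k => Finset.card_pos.1 ((Nat.zero_le _).trans_lt (hT k))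
      choose f hf using hne
      exact ⟨f, hf, by simp⟩
    | insert k s hk ih =>
      obtain ⟨f, hf, hs⟩ := ih
      have hlt : #(s.biUnion fun l => ({x | C (f l) x} : Finset V)) < #(T k) := by
        refine lt_of_le_of_lt ?_ (hT k)
        calc _ ≤ #s * b := Finset.card_biUnion_le_card_mul _ _ _ fun l _ => hb l _ (hf l)
          _ ≤ _ := Nat.mul_le_mul_right _ (Finset.card_le_univ s)
      obtain ⟨w, hwT, hw⟩ := Finset.exists_mem_notMem_of_card_lt_card hlt
      simp only [mem_biUnion, mem_filter, mem_univ, true_and, not_exists, not_and] at hw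
      refine ⟨Function.update f k w, fun l => ?_, fun l hl m hm hlm => ?_⟩
      · by_cases h : l = k
        · subst h; simpa using hwT
        · rw [Function.update_of_ne h]; exact hf l
      · rcases Finset.mem_insert.1 hl with rfl | hl'
        · have hm' : m ∈ s := (Finset.mem_insert.1 hm).resolve_left (Ne.symm hlm)
          rw [Function.update_self, Function.update_of_ne hlm.symm]
          exact fun hcon => hw m hm' (hC _ _ hcon)
        · have hlk : l ≠ k := fun h => hk (h ▸ hl')
          rw [Function.update_of_ne hlk]
          by_cases hmk : m = k
          · subst hmk; rw [Function.update_self]; exact hw l hl'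
          · rw [Function.update_of_ne hmk]
            exact hs l hl' m ((Finset.mem_insert.1 hm).resolve_left hmk) hlm
  obtain ⟨f, hf, h⟩ := key univ
  exact ⟨f, hf, fun k l => h k (mem_univ _) l (mem_univ _)⟩

/-- Large candidate sets of vertices missing few cross edges contain a balanced complete
multipartite graph. -/
lemma exists_complete_multipartite {n r : ℕ} (t b : ℕ) (G : SimpleGraph (Fin n))
    (p : Fin n → Fin r) (T : Fin r → Finset (Fin n)) (hTp : ∀ j, ∀ w ∈ T j, p w = j)
    (hb : ∀ j, ∀ w ∈ T j, missDeg G p w + 1 ≤ b) (hT : ∀ j, r * t * b < #(T j)) :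
    ∃ U : Fin r → Finset (Fin n), (∀ j, U j ⊆ T j) ∧ (∀ j, #(U j) = t) ∧
      ∀ j k, j ≠ k → ∀ u ∈ U j, ∀ w ∈ U k, G.Adj u w := by
  classical
  obtain ⟨f, hf, hconf⟩ := exists_conflict_free (ι := Fin r × Fin t)
    (fun x y => x = y ∨ (p x ≠ p y ∧ ¬ G.Adj x y))
    (fun x y h => h.imp Eq.symm fun h => ⟨h.1.symm, fun h' => h.2 h'.symm⟩) b (fun k => T k.1)
    (fun k w hw => by
      refine le_trans ?_ (hb k.1 w hw)
      refine le_trans (Finset.card_le_card fun y hy => ?_) (Finset.card_insert_le w _)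
      simp only [mem_filter, mem_univ, true_and] at hy
      simp only [mem_insert, mem_filter, mem_univ, true_and]
      exact hy.imp Eq.symm id)
    (fun k => by simpa using hT k.1)
  have hinj : Function.Injective f := fun k l hkl => by
    by_contra hne
    exact hconf k l hne (Or.inl hkl)
  refine ⟨fun j => univ.image fun k : Fin t => f (j, k), fun j => ?_, fun j => ?_, ?_⟩
  · exact Finset.image_subset_iff.2 fun k _ => hf (j, k)
  · rw [Finset.card_image_of_injective _ fun k l hkl => (Prod.ext_iff.1 (hinj hkl)).2]
    simp
  · intro j k hjk u hu w hw
    obtain ⟨x, -, rfl⟩ := Finset.mem_image.1 hu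
    obtain ⟨y, -, rfl⟩ := Finset.mem_image.1 hw
    have h := hconf (j, x) (k, y) (fun h => hjk (Prod.ext_iff.1 h).1)
    by_contra hcon
    refine h (Or.inr ⟨?_, hcon⟩)
    rw [hTp j _ (hf (j, x)), hTp k _ (hf (k, y))]
    exact hjk

open scoped Classical in
/-- A small set `D` inside one part, completely joined to large candidate sets in the other
parts, extends to a balanced complete multipartite graph. -/
lemma exists_balanced_extension {n r t : ℕ} (G : SimpleGraph (Fin n)) (p : Fin n → Fin r)
    {x : ℝ} (hrt : 0 < r * t) (hx : 2 * ((r * t : ℕ) : ℝ) < x)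
    (hB : (#{u | x / ((r * t : ℕ) : ℝ) < missDeg G p u} : ℝ) ≤ x / 2)
    (i : Fin r) (D : Finset (Fin n)) (hD : ∀ v ∈ D, p v = i) (hDt : #D ≤ t)
    (S : Fin r → Finset (Fin n)) (hS : ∀ j, ∀ w ∈ S j, p w = j)
    (hSD : ∀ j, j ≠ i → ∀ w ∈ S j, ∀ v ∈ D, G.Adj v w) (hSi : Disjoint (S i) D)
    (hcard : ∀ j, 2 * x ≤ #(S j)) :
    ∃ U : Finset (Fin n), (∀ j, #{u ∈ U | p u = j} = t) ∧
      (∀ u ∈ U, ∀ w ∈ U, p u ≠ p w → G.Adj u w) ∧ D ⊆ U ∧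
      ∀ u ∈ U, p u = i → u ∉ D → u ∈ S i := by
  set N := r * t with hN
  have hN' : (0 : ℝ) < N := by exact_mod_cast hrt
  set B : Finset (Fin n) := {u | x / (N : ℝ) < missDeg G p u}
  have hx0 : 0 < x := by linarith
  have hfl : (⌊x / N⌋₊ : ℝ) ≤ x / N := Nat.floor_le (by positivity)
  obtain ⟨U, hUT, hUt, hU⟩ := exists_complete_multipartite t (⌊x / N⌋₊ + 1) G p
    (fun j => S j \ B) (fun j w hw => hS j w (Finset.mem_sdiff.1 hw).1)
    (fun j w hw => by
      have h := (Finset.mem_sdiff.1 hw).2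
      simp only [B, mem_filter, mem_univ, true_and, not_lt] at h
      exact Nat.succ_le_succ (Nat.le_floor h))
    (fun j => by
      have h1 : (#(S j) : ℝ) ≤ #(S j \ B) + #B := by
        exact_mod_cast tsub_le_iff_right.1 (Finset.le_card_sdiff B (S j))
      have h2 : ((N * (⌊x / N⌋₊ + 1) : ℕ) : ℝ) < #(S j \ B) := by
        push_cast
        have h3 : (N : ℝ) * (⌊x / N⌋₊ + 1) ≤ N * (x / N + 1) := by gcongr
        have h4 : (N : ℝ) * (x / N + 1) = x + N := by field_simp
        linarith [hcard j]
      exact_mod_cast h2)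
  obtain ⟨R, hRU, hRc⟩ := Finset.exists_subset_card_eq (s := U i) (n := t - #D)
    (by rw [hUt]; omega)
  have hUS : ∀ j, ∀ w ∈ U j, w ∈ S j := fun j w hw => (Finset.mem_sdiff.1 (hUT j hw)).1
  have hRS : ∀ w ∈ R, w ∈ S i := fun w hw => hUS i w (hRU hw)
  let Q : Fin r → Finset (Fin n) := fun j => if j = i then D ∪ R else U j
  have hQp : ∀ j, ∀ w ∈ Q j, p w = j := by
    intro j w hw
    by_cases hj : j = i
    · subst hj
      simp only [Q, if_true, mem_union] at hw
      exact hw.elim (hD w) fun h => hS _ w (hRS w h)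
    · simp only [Q, hj, if_false] at hw
      exact hS j w (hUS j w hw)
  have hfil : ∀ j, (univ.biUnion Q).filter (fun u => p u = j) = Q j := by
    intro j
    ext u
    simp only [mem_filter, mem_biUnion, mem_univ, true_and]
    constructor
    · rintro ⟨⟨k, hk⟩, hj⟩
      rwa [← hj, hQp k u hk]
    · exact fun h => ⟨⟨j, h⟩, hQp j u h⟩
  have hmem : ∀ u ∈ univ.biUnion Q, u ∈ Q (p u) := fun u hu => by
    rw [← hfil (p u)]; exact Finset.mem_filter.2 ⟨hu, rfl⟩
  have hadj : ∀ u ∈ Q i, ∀ j, j ≠ i → ∀ w ∈ Q j, G.Adj u w := by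
    intro u hu j hj w hw
    simp only [Q, if_true, mem_union] at hu
    simp only [Q, hj, if_false] at hw
    exact hu.elim (fun h => hSD j hj w (hUS j w hw) u h) fun h => hU i j hj.symm u (hRU h) w hw
  refine ⟨univ.biUnion Q, fun j => ?_, fun u hu w hw huw => ?_, fun v hv => ?_,
    fun u hu hui huD => ?_⟩
  · rw [hfil]
    by_cases hj : j = i
    · simp only [Q, hj, if_true]
      rw [Finset.card_union_of_disjoint, hRc]
      · omega
      · exact Finset.disjoint_left.2 fun v hv hR => Finset.disjoint_left.1 hSi (hRS v hR) hv
    · simp only [Q, hj, if_false]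
      exact hUt j
  · have hu' := hmem u hu
    have hw' := hmem w hw
    by_cases h1 : p u = i
    · rw [h1] at hu'
      exact hadj u hu' (p w) (fun h => huw (h1.trans h.symm)) w hw'
    · by_cases h2 : p w = i
      · rw [h2] at hw'
        exact (hadj w hw' (p u) h1 u hu').symm
      · simp only [Q, h1, h2, if_false] at hu' hw'
        exact hU _ _ huw u hu' w hw'
  · refine Finset.mem_biUnion.2 ⟨i, mem_univ _, ?_⟩
    simp [Q, hv]
  · have hu' := hmem u hu
    rw [hui] at hu'
    simp only [Q, if_true, mem_union] at hu'
    exact hRS u (hu'.resolve_left huD)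

end Greedy

section Structure

open scoped Classical in
lemma missDeg_add_deg {n r : ℕ} (G : SimpleGraph (Fin n)) (p : Fin n → Fin r) (u : Fin n) :
    missDeg G p u + deg G u + partSize p (p u) = n + degIn G p (p u) u := by
  have hdeg : deg G u = #{w | G.Adj u w} := by
    rw [deg, Nat.card_eq_fintype_card, ← Set.toFinset_card]
    congr 1
    ext w
    simp
  have hpart : partSize p (p u) = #{w | p w = p u} := by
    rw [partSize, Nat.card_eq_fintype_card, Fintype.card_subtype]
  have h1 := Finset.card_filter_add_card_filter_not (s := (univ : Finset (Fin n)))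
    (fun w => p w = p u)
  have h2 := Finset.card_filter_add_card_filter_not
    (s := univ.filter fun w => ¬ p w = p u) (fun w => G.Adj u w)
  have h3 := Finset.card_filter_add_card_filter_not
    (s := univ.filter fun w => G.Adj u w) (fun w => p w = p u)
  rw [Finset.filter_filter, Finset.filter_filter] at h2 h3
  have h4 : #{w | ¬ p w = p u ∧ G.Adj u w} = #{w | G.Adj u w ∧ ¬ p w = p u} := by
    simp only [and_comm]
  have h5 : missDeg G p u = #{w | ¬ p w = p u ∧ ¬ G.Adj u w} := by
    simp only [missDeg, ne_eq, eq_comm]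
  have h6 := degIn_eq G p (p u) u
  rw [Finset.card_univ, Fintype.card_fin] at h1
  omega

/-- Markov's inequality for `missDeg`. -/
lemma card_mul_le_sum_missDeg {n r : ℕ} (G : SimpleGraph (Fin n)) (p : Fin n → Fin r) {c : ℝ}
    (s : Finset (Fin n)) (hs : ∀ u ∈ s, c ≤ missDeg G p u) :
    #s * c ≤ (∑ u, missDeg G p u : ℝ) := by
  rw [← nsmul_eq_mul]
  exact (Finset.card_nsmul_le_sum s _ c hs).trans
    (Finset.sum_le_univ_sum_of_nonneg fun u => Nat.cast_nonneg _)

open scoped Classical in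
lemma card_missDeg_gt_le {n r : ℕ} (G : SimpleGraph (Fin n)) (p : Fin n → Fin r) {θ ε N : ℝ}
    (hn : (0 : ℝ) < n) (hθ : 0 < θ) (hN : 0 < N) (hNθ : 22 * (N * θ) ≤ 1) (hεθ : 2 * ε ≤ θ ^ 3)
    (hmiss : (∑ u, missDeg G p u : ℝ) ≤ 22 * ε * n ^ 2) :
    (#{u | θ * n / N < missDeg G p u} : ℝ) ≤ θ * n / 2 := by
  have h1 := card_mul_le_sum_missDeg G p (c := θ * n / N) {u | θ * n / N < missDeg G p u}
    (fun u hu => (Finset.mem_filter.1 hu).2.le)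
  generalize (#{u | θ * n / N < missDeg G p u} : ℝ) = b at h1 ⊢
  have h2 : b * (θ * n) ≤ 22 * ε * n ^ 2 * N := by
    have := h1.trans hmiss
    rwa [mul_div_assoc', div_le_iff₀ hN] at this
  have h3 : 22 * ε * N ≤ 11 * θ ^ 3 * N := by gcongr ?_ * N; linarith
  have h4 : 11 * θ ^ 3 * N ≤ θ ^ 2 / 2 := by nlinarith [pow_pos hθ 2]
  have h5 : 22 * ε * n ^ 2 * N ≤ θ * n / 2 * (θ * n) := by
    calc 22 * ε * n ^ 2 * N = 22 * ε * N * n ^ 2 := by ring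
      _ ≤ θ ^ 2 / 2 * n ^ 2 := by gcongr; linarith
      _ = θ * n / 2 * (θ * n) := by ring
  exact le_of_mul_le_mul_right (h2.trans h5) (by positivity)

lemma card_le_of_missDeg_ge {n r : ℕ} (G : SimpleGraph (Fin n)) (p : Fin n → Fin r) {δ : ℝ}
    (hn : (0 : ℝ) < n) (hδ : 0 < δ) (hδ' : 22 * δ ≤ 3)
    (hmiss : (∑ u, missDeg G p u : ℝ) ≤ 22 * δ ^ 3 * n ^ 2) (s : Finset (Fin n))
    (hs : ∀ u ∈ s, 3 * δ * n ≤ missDeg G p u) : (#s : ℝ) ≤ δ * n := by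
  have h1 := card_mul_le_sum_missDeg G p s hs
  have h2 : 22 * δ ^ 3 * n ^ 2 ≤ δ * n * (3 * δ * n) := by
    calc 22 * δ ^ 3 * n ^ 2 = 22 * δ * (δ ^ 2 * n ^ 2) := by ring
      _ ≤ 3 * (δ ^ 2 * n ^ 2) := by gcongr
      _ = δ * n * (3 * δ * n) := by ring
  exact le_of_mul_le_mul_right ((h1.trans hmiss).trans h2) (by positivity)

lemma rpow_third_bounds {ε θ : ℝ} (hε : 0 < ε) (hθ : 0 < θ) (hθ1 : θ ≤ 1)
    (hεθ : 2 * ε < θ ^ 3) :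
    0 < ε ^ ((1 : ℝ) / 3) ∧ (ε ^ ((1 : ℝ) / 3)) ^ 3 = ε ∧ ε ^ ((1 : ℝ) / 3) < θ ∧
      Real.sqrt ε ≤ ε ^ ((1 : ℝ) / 3) := by
  have hδ0 : 0 < ε ^ ((1 : ℝ) / 3) := Real.rpow_pos_of_pos hε _
  have hδ3 : (ε ^ ((1 : ℝ) / 3)) ^ 3 = ε := by
    rw [← Real.rpow_natCast, ← Real.rpow_mul hε.le]
    norm_num
  generalize ε ^ ((1 : ℝ) / 3) = δ at hδ0 hδ3 ⊢
  have hδθ : δ < θ := lt_of_pow_lt_pow_left₀ 3 hθ.le (by rw [hδ3]; linarith)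
  refine ⟨hδ0, hδ3, hδθ, ?_⟩
  rw [← Real.sqrt_sq hδ0.le]
  refine Real.sqrt_le_sqrt ?_
  rw [← hδ3]
  exact pow_le_pow_of_le_one hδ0.le (by linarith) (by norm_num)

open scoped Classical in
/-- In an `F`-free graph with a maximum cut missing few cross edges, every vertex has few
neighbours in its own part. -/
lemma degIn_self_lt {W : Type*} {F : SimpleGraph W} {n r t a : ℕ} (hr : 0 < r)
    (hF : exNum (r * t) F = eCnt (turanGraph (r * t) r) + a) (hta : a + 2 ≤ t)
    {G : SimpleGraph (Fin n)} (hG : FFree F G) {p : Fin n → Fin r}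
    (hp : ∀ q : Fin n → Fin r, crossCnt G q ≤ crossCnt G p)
    {x : ℝ} (hx : 2 * ((r * t : ℕ) : ℝ) < x)
    (hB : (#{u | x / ((r * t : ℕ) : ℝ) < missDeg G p u} : ℝ) ≤ x / 2) (v : Fin n) :
    (degIn G p (p v) v : ℝ) < 2 * x := by
  by_contra! hv
  obtain ⟨U, hU, hadj, hDU, hUS⟩ := exists_balanced_extension G p
    (Nat.mul_pos hr (by omega)) hx hB (p v) {v} (by simp) (by simp; omega)
    (fun j => {w | G.Adj v w ∧ p w = j}) (by simp) (by simp +contextual)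
    (by simp)
    (fun j => by
      rw [← degIn_eq]
      exact hv.trans (by exact_mod_cast degIn_self_le G p hp v j))
  refine hG (contains_of_balanced hr hF U hU hadj ?_)
  have hvU : v ∈ U := hDU (by simp)
  set R := (U.filter fun u => p u = p v).erase v with hR
  have hRc : #R = t - 1 := by
    rw [hR, Finset.card_erase_of_mem (by simp [hvU]), hU]
  have hRm : ∀ u ∈ R, u ∈ U ∧ p u = p v ∧ u ≠ v ∧ G.Adj v u := by
    intro u hu
    simp only [hR, mem_erase, mem_filter] at hu
    have := hUS u hu.2.1 hu.2.2 (by simpa using hu.1)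
    simp only [mem_filter, mem_univ, true_and] at this
    exact ⟨hu.2.1, hu.2.2, hu.1, this.1⟩
  have hsub : R.image (fun u => (v, u)) ∪ R.image (fun u => (u, v)) ⊆
      {x ∈ U ×ˢ U | G.Adj x.1 x.2 ∧ p x.1 = p x.2} := by
    intro y hy
    rw [mem_union, mem_image, mem_image] at hy
    rcases hy with ⟨u, hu, rfl⟩ | ⟨u, hu, rfl⟩
    · obtain ⟨h1, h2, -, h4⟩ := hRm u hu
      simp [hvU, h1, h2, h4]
    · obtain ⟨h1, h2, -, h4⟩ := hRm u hu
      simp [hvU, h1, h2, h4.symm]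
  refine le_trans ?_ (Finset.card_le_card hsub)
  rw [Finset.card_union_of_disjoint, Finset.card_image_of_injective _ (Prod.mk_right_injective v),
    Finset.card_image_of_injective _ (Prod.mk_left_injective v), hRc]
  · omega
  · rw [Finset.disjoint_left]
    rintro y hy hy'
    obtain ⟨u, hu, rfl⟩ := Finset.mem_image.1 hy
    obtain ⟨w, hw, h⟩ := Finset.mem_image.1 hy'
    exact (hRm w hw).2.2.1 (Prod.ext_iff.1 h).1

open scoped Classical in
/-- Vertices of one part which miss few cross edges span at most `a` edges. -/
lemma card_edges_le_of_missDeg_le {W : Type*} {F : SimpleGraph W} {n r t a : ℕ} (hr : 0 < r)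
    (hF : exNum (r * t) F = eCnt (turanGraph (r * t) r) + a) (hta : 2 * (a + 1) ≤ t)
    {G : SimpleGraph (Fin n)} (hG : FFree F G) {p : Fin n → Fin r}
    {x y : ℝ} (hx : 2 * ((r * t : ℕ) : ℝ) < x)
    (hB : (#{u | x / ((r * t : ℕ) : ℝ) < missDeg G p u} : ℝ) ≤ x / 2)
    (hy : 1 ≤ y) (hpart : ∀ j, 2 * x + t * y ≤ partSize p j)
    (i : Fin r) (A : Set (Fin n)) (hA : ∀ v ∈ A, p v = i ∧ (missDeg G p v : ℝ) ≤ y) :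
    Nat.card {e : Sym2 (Fin n) // e ∈ G.edgeSet ∧ ∀ v ∈ e, v ∈ A} ≤ a := by
  by_contra! hlt
  have hpartc : ∀ j, partSize p j = #{w | p w = j} := fun j => by
    rw [partSize, Nat.card_eq_fintype_card, Fintype.card_subtype]
  rw [Nat.card_eq_fintype_card, Fintype.card_subtype] at hlt
  obtain ⟨K, hKs, hKc⟩ := Finset.exists_subset_card_eq (Nat.add_one_le_of_lt hlt)
  have hK : ∀ e ∈ K, e ∈ G.edgeSet ∧ ∀ v ∈ e, v ∈ A := fun e he => by
    simpa using hKs he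
  set D : Finset (Fin n) := K.biUnion fun e => e.toFinset
  have hDc : #D ≤ t := by
    refine (Finset.card_biUnion_le_card_mul _ _ 2 fun e he => ?_).trans (by rw [hKc]; omega)
    rw [Sym2.card_toFinset]
    split_ifs <;> omega
  have hDA : ∀ v ∈ D, v ∈ A := fun v hv => by
    obtain ⟨e, he, hve⟩ := Finset.mem_biUnion.1 hv
    exact (hK e he).2 v (Sym2.mem_toFinset.1 hve)
  have hty : (t : ℝ) ≤ t * y := le_mul_of_one_le_right (Nat.cast_nonneg _) hy
  have hDcr : (#D : ℝ) ≤ t := by exact_mod_cast hDc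
  let S : Fin r → Finset (Fin n) := fun j =>
    if j = i then (univ.filter fun w => p w = i) \ D
    else univ.filter fun w => p w = j ∧ ∀ v ∈ D, G.Adj v w
  have hScard : ∀ j, 2 * x ≤ #(S j) := by
    intro j
    have hj := hpart j
    rw [hpartc] at hj
    by_cases hji : j = i
    · subst hji
      simp only [S, if_true]
      have h1 : (#(univ.filter fun w => p w = j) : ℝ) ≤
          #((univ.filter fun w => p w = j) \ D) + #D := by
        exact_mod_cast tsub_le_iff_right.1 (Finset.le_card_sdiff D _)
      linarith
    · simp only [S, hji, if_false]
      have hsub : (univ.filter fun w => p w = j) ⊆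
          (univ.filter fun w => p w = j ∧ ∀ v ∈ D, G.Adj v w) ∪
            D.biUnion fun v => univ.filter fun w => p v ≠ p w ∧ ¬ G.Adj v w := by
        intro w hw
        simp only [mem_filter, mem_univ, true_and] at hw
        simp only [mem_union, mem_filter, mem_univ, true_and, mem_biUnion]
        by_cases hall : ∀ v ∈ D, G.Adj v w
        · exact Or.inl ⟨hw, hall⟩
        · push Not at hall
          obtain ⟨v, hv, hvw⟩ := hall
          refine Or.inr ⟨v, hv, ?_, hvw⟩
          rw [(hA v (hDA v hv)).1, hw]
          exact fun h => hji h.symm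
      have h1 := (Finset.card_le_card hsub).trans (Finset.card_union_le _ _)
      have h2 : (#(D.biUnion fun v => univ.filter fun w => p v ≠ p w ∧ ¬ G.Adj v w) : ℝ) ≤
          #D * y := by
        calc _ ≤ ((∑ v ∈ D, missDeg G p v : ℕ) : ℝ) := by
              exact_mod_cast Finset.card_biUnion_le
          _ ≤ #D * y := by
              push_cast
              rw [← nsmul_eq_mul]
              exact Finset.sum_le_card_nsmul _ _ _ fun v hv => (hA v (hDA v hv)).2
      have h3 : (#D : ℝ) * y ≤ t * y := by gcongr
      have h1' : (#(univ.filter fun w => p w = j) : ℝ) ≤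
          #(univ.filter fun w => p w = j ∧ ∀ v ∈ D, G.Adj v w) +
          #(D.biUnion fun v => univ.filter fun w => p v ≠ p w ∧ ¬ G.Adj v w) := by
        exact_mod_cast h1
      linarith
  obtain ⟨U, hU, hadj, hDU, -⟩ := exists_balanced_extension G p
    (Nat.mul_pos hr (by omega)) hx hB i D (fun v hv => (hA v (hDA v hv)).1) hDc S
    (fun j w hw => by
      by_cases hji : j = i
      · simp only [S, hji, if_true, mem_sdiff, mem_filter, mem_univ, true_and] at hw
        rw [hw.1, hji]
      · simp only [S, hji, if_false, mem_filter, mem_univ, true_and] at hw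
        exact hw.1)
    (fun j hji w hw v hv => by
      simp only [S, hji, if_false, mem_filter, mem_univ, true_and] at hw
      exact hw.2 v hv)
    (by simp only [S, if_true]; exact Finset.sdiff_disjoint)
    hScard
  refine hG (contains_of_balanced hr hF U hU hadj ?_)
  have h1 := two_mul_card_edges_filter G (fun e => e ∈ K)
  have h2 : Nat.card {e : Sym2 (Fin n) // e ∈ G.edgeSet ∧ e ∈ K} = a + 1 := by
    rw [Nat.card_eq_fintype_card, Fintype.card_subtype, ← hKc]
    congr 1
    ext e
    simp only [mem_filter, mem_univ, true_and]
    exact ⟨fun h => h.2, fun h => ⟨(hK e h).1, h⟩⟩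
  rw [← h2, h1]
  refine Finset.card_le_card fun z hz => ?_
  simp only [mem_filter, mem_univ, true_and] at hz
  have hz1 : z.1 ∈ D := Finset.mem_biUnion.2 ⟨_, hz.2, by simp⟩
  have hz2 : z.2 ∈ D := Finset.mem_biUnion.2 ⟨_, hz.2, by simp⟩
  simp only [mem_filter, mem_product]
  refine ⟨⟨hDU hz1, hDU hz2⟩, hz.1, ?_⟩
  rw [(hA _ (hDA _ hz1)).1, (hA _ (hDA _ hz2)).1]

/-- Deleting one end of every edge inside `A` leaves an independent set. -/
lemma exists_independent_subset {n a : ℕ} (G : SimpleGraph (Fin n)) (A : Set (Fin n))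
    (hA : Nat.card {e : Sym2 (Fin n) // e ∈ G.edgeSet ∧ ∀ v ∈ e, v ∈ A} ≤ a) :
    ∃ I : Set (Fin n), I ⊆ A ∧ (∀ u ∈ I, ∀ v ∈ I, ¬ G.Adj u v) ∧ Nat.card A ≤ Nat.card I + a := by
  classical
  let K : Finset (Sym2 (Fin n)) := {e | e ∈ G.edgeSet ∧ ∀ v ∈ e, v ∈ A}
  let R : Finset (Fin n) := K.image fun e => e.out.1
  have hR : #R ≤ a := by
    refine Finset.card_image_le.trans ?_
    rwa [Nat.card_eq_fintype_card, Fintype.card_subtype] at hA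
  refine ⟨A \ R, Set.sdiff_subset, fun u hu v hv huv => ?_, ?_⟩
  · have hK : s(u, v) ∈ K := by
      simp only [K, mem_filter, mem_univ, true_and, SimpleGraph.mem_edgeSet, Sym2.mem_iff]
      refine ⟨huv, ?_⟩
      rintro w (rfl | rfl)
      · exact hu.1
      · exact hv.1
    have hmem : (s(u, v)).out.1 ∈ R := Finset.mem_image_of_mem _ hK
    rcases Sym2.mem_iff.1 (Sym2.out_fst_mem s(u, v)) with h | h
    · exact hu.2 (by rw [h] at hmem; exact hmem)
    · exact hv.2 (by rw [h] at hmem; exact hmem)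
  · have h1 := Set.ncard_le_ncard_sdiff_add_ncard A (R : Set (Fin n))
    rw [Set.ncard_coe_finset] at h1
    change A.ncard ≤ (A \ (R : Set (Fin n))).ncard + a
    omega

end Structure

theorem stmt_10 {W : Type*} (r a : ℕ) (hr : 2 ≤ r) (F : SimpleGraph W) (h : HypStar r a F) :
    ∃ ℓ₀ : ℕ, ∀ ℓ ≥ ℓ₀, ∀ θ ε : ℝ, 0 < θ → 0 < ε →
      θ < 1 / (100 * r ^ 5 * ℓ) → 2 * ε < θ ^ 3 →
      ∃ n₀ : ℕ, ∀ n ≥ n₀, ∀ G : SimpleGraph (Fin n), SpecExtremal F G →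
        ∀ p : Fin n → Fin r, GoodPartition r G ε p →
          ∀ i : Fin r,
            Nat.card {e : Sym2 (Fin n) //
                e ∈ G.edgeSet ∧ ∀ v ∈ e, p v = i ∧ v ∉ Lset r G ε} ≤ a ∧
            ∃ I : Set (Fin n), I ⊆ {v | p v = i ∧ v ∉ Lset r G ε} ∧
              (∀ u ∈ I, ∀ v ∈ I, ¬ G.Adj u v) ∧
              (partSize p i : ℝ) - ε ^ ((1 : ℝ) / 3) * n - a ≤ Nat.card I := by
  classical
  obtain ⟨m₀, hm⟩ := h
  set t := m₀ + 2 * (a + 1) with ht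
  have hr0 : 0 < r := by omega
  have hrt : 0 < r * t := Nat.mul_pos hr0 (by omega)
  have hF := (hm (r * t) (le_trans (by omega) (Nat.le_mul_of_pos_left t hr0))).1
  refine ⟨r * t, fun ℓ hℓ θ ε hθ hε hθℓ hεθ => ?_⟩
  have hr2 : (2 : ℝ) ≤ r := by exact_mod_cast hr
  have ht1 : (1 : ℝ) ≤ t := by exact_mod_cast (by omega : 1 ≤ t)
  set N : ℝ := ((r * t : ℕ) : ℝ) with hN
  have hNrt : N = r * t := by rw [hN]; push_cast; rfl
  have hNpos : 0 < N := by rw [hN]; exact_mod_cast hrt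
  have hNℓ : N ≤ ℓ := by rw [hN]; exact_mod_cast hℓ
  have hθN : 100 * r ^ 5 * N * θ < 1 := by
    rw [lt_div_iff₀ (by have := hNpos.trans_le hNℓ; positivity)] at hθℓ
    calc 100 * (r : ℝ) ^ 5 * N * θ ≤ 100 * r ^ 5 * ℓ * θ := by gcongr
      _ < 1 := by linarith
  have hr4 : (16 : ℝ) ≤ r ^ 4 := by
    calc (16 : ℝ) = 2 ^ 4 := by norm_num
      _ ≤ r ^ 4 := by gcongr
  have hrN : 1600 * (r * N * θ) < 1 := by
    have : 16 * (r * N * θ) ≤ r ^ 4 * (r * N * θ) := by gcongr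
    nlinarith
  have hNθ : 3200 * (N * θ) < 1 := by
    have : 2 * (N * θ) ≤ r * (N * θ) := by gcongr
    nlinarith
  have hN1 : 2 ≤ N := by rw [hNrt]; nlinarith
  have hθ1 : 6400 * θ < 1 := by nlinarith
  set δ : ℝ := ε ^ ((1 : ℝ) / 3) with hδ
  obtain ⟨hδ0, hδ3, hδθ, hsqrt⟩ : 0 < δ ∧ δ ^ 3 = ε ∧ δ < θ ∧ Real.sqrt ε ≤ δ :=
    rpow_third_bounds hε hθ (by linarith) hεθ
  have hεsmall : ε ≤ 1 / 1000 := by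
    nlinarith [pow_le_one₀ hθ.le (by linarith : θ ≤ 1) (n := 2)]
  obtain ⟨n₁, hn₁⟩ := le_specRad_of_specExtremal hr ⟨m₀, hm⟩ hε
  obtain ⟨n₂, hn₂⟩ := exists_nat_gt (2 * N / θ)
  refine ⟨n₁ + n₂ + 1, fun n hn G hG p hp i => ?_⟩
  obtain ⟨hmax, hin, hpart⟩ := hp
  have hlam := hn₁ n (by omega) G hG
  have hn0 : (0 : ℝ) < n := by exact_mod_cast (by omega : 0 < n)
  have hx : 2 * N < θ * n := by
    have : (n₂ : ℝ) ≤ n := by exact_mod_cast (by omega : n₂ ≤ n)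
    rw [div_lt_iff₀ hθ] at hn₂
    nlinarith
  have hin' : (#{x : Fin n × Fin n | G.Adj x.1 x.2 ∧ p x.1 = p x.2} : ℝ) ≤ 2 * ε * n ^ 2 := by
    have h1 : (2 * ∑ i, (inCnt G p i : ℝ)) =
        #{x : Fin n × Fin n | G.Adj x.1 x.2 ∧ p x.1 = p x.2} := by
      exact_mod_cast two_mul_sum_inCnt G p
    linarith
  have hmiss := sum_missDeg_le hr (by omega) G p hε hεsmall hlam hin'
  have hB : (#{u | θ * n / N < missDeg G p u} : ℝ) ≤ θ * n / 2 :=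
    card_missDeg_gt_le G p hn0 hθ hNpos (by linarith) hεθ.le hmiss
  have hdegIn := degIn_self_lt hr0 hF (by omega) hG.1 hmax hx hB
  have hident : ∀ u, (missDeg G p u : ℝ) + deg G u + partSize p (p u) =
      n + degIn G p (p u) u := fun u => by exact_mod_cast missDeg_add_deg G p u
  have hsn : Real.sqrt ε * n ≤ δ * n := by gcongr
  have hδn : δ * n ≤ θ * n := by gcongr
  have hrθ : 2 * (θ * n) ≤ r * (θ * n) := by gcongr
  have hcore : Nat.card {e : Sym2 (Fin n) //
      e ∈ G.edgeSet ∧ ∀ v ∈ e, v ∈ {v | p v = i ∧ v ∉ Lset r G ε}} ≤ a := by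
    refine card_edges_le_of_missDeg_le hr0 hF (by omega) hG.1 hx hB (y := 6 * r * θ * n)
      (by linarith) (fun j => ?_) i _ (fun v hv => ⟨hv.1, ?_⟩)
    · have h1 := (hpart j).1
      have h2 : 5 * θ + 6 * N * θ ≤ 1 / r := by
        rw [le_div_iff₀ (by linarith)]
        have h3 : r * θ * 1 ≤ r * θ * N := by gcongr; linarith
        linarith
      have h3 : (5 * θ + 6 * N * θ) * n ≤ 1 / r * n := by gcongr
      rw [hNrt] at h3
      linarith
    · have h1 := hident v
      have h2 := (hpart (p v)).1
      have h3 := hdegIn v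
      have h4 : (1 - 1 / (r : ℝ) - 3 * r * δ) * n < deg G v := not_le.1 hv.2
      have h5 : r * (δ * n) ≤ r * (θ * n) := by gcongr
      linarith
  refine ⟨hcore, ?_⟩
  obtain ⟨I, hI, hind, hIc⟩ := exists_independent_subset G _ hcore
  refine ⟨I, hI, hind, ?_⟩
  set Lf : Finset (Fin n) := {v | v ∈ Lset r G ε}
  have hL : (#Lf : ℝ) ≤ δ * n := by
    refine card_le_of_missDeg_ge G p hn0 hδ0 (by linarith) (hδ3 ▸ hmiss) Lf fun u hu => ?_
    have h1 := hident u
    have h2 := (hpart (p u)).2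
    have h3 : (deg G u : ℝ) ≤ (1 - 1 / (r : ℝ) - 3 * r * δ) * n := (Finset.mem_filter.1 hu).2
    have h4 : (0 : ℝ) ≤ degIn G p (p u) u := Nat.cast_nonneg _
    have h5 : 2 * (δ * n) ≤ r * (δ * n) := by gcongr
    linarith
  have hVL : partSize p i ≤ Nat.card {v | p v = i ∧ v ∉ Lset r G ε} + #Lf := by
    have h1 := Set.ncard_le_ncard_sdiff_add_ncard {v | p v = i} (Lf : Set (Fin n))
    rw [Set.ncard_coe_finset] at h1
    have h2 : {v | p v = i} \ (Lf : Set (Fin n)) = {v | p v = i ∧ v ∉ Lset r G ε} := by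
      ext v
      simp [Lf]
    rw [h2] at h1
    exact h1
  have h1 : (partSize p i : ℝ) ≤ Nat.card I + a + #Lf := by
    exact_mod_cast hVL.trans (Nat.add_le_add_right hIc _)
  linarith
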